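/- Consider the Tavin risk-sharing scheme with two participants and an active administrator: I_1, I_2 are independent Bernoulli random variables with Pr[I_i = 1] = p_i ∈ (0,1), q_i = 1 − p_i, I_3 = (1 − I_1)·(1 − I_2), and for strictly positive investments π_1, π_2, π_3 the compensations are W_i = (π_1 + π_2 + π_3) · π_i·I_i / (π_1·I_1 + π_2·I_2 + π_3·I_3) for i = 1,2,3. The scheme is actuarially fair for all three agents (π_i = E[W_i] for i = 1,2,3) if and only if π_1 = π_3 · (p_1/q_1) · (1 − q_1·q_2) / (p_1·q_2 + p_2·q_1) and π_2 = π_3 · (p_2/q_2) · (1 − q_1·q_2) / (p_1·q_2 + p_2·q_1). -/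

import Mathlib

open MeasureTheory

/-- A random variable with values in `{0, 1}` has as expectation the probability of the value `1`. -/
lemma integral_eq_prob_of_zero_or_one {Ω : Type*} [MeasurableSpace Ω] {μ : Measure Ω}
    {I : Ω → ℝ} (hm : Measurable I) (h01 : ∀ ω, I ω = 0 ∨ I ω = 1) :
    ∫ ω, I ω ∂μ = (μ {ω | I ω = 1}).toReal := by
  have h : I = Set.indicator {ω | I ω = 1} 1 := by
    ext ω
    rcases h01 ω with h | h <;> simp [Set.indicator, h]
  have hs : MeasurableSet {ω | I ω = 1} := hm (measurableSet_singleton 1)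
  calc ∫ ω, I ω ∂μ = ∫ ω, Set.indicator {ω | I ω = 1} 1 ω ∂μ := by rw [← h]
    _ = (μ {ω | I ω = 1}).toReal := integral_indicator_one hs

/-- A measurable random variable with values in `{0, 1}` is integrable. -/
lemma integrable_of_zero_or_one {Ω : Type*} [MeasurableSpace Ω] {μ : Measure Ω}
    [IsFiniteMeasure μ] {I : Ω → ℝ} (hm : Measurable I) (h01 : ∀ ω, I ω = 0 ∨ I ω = 1) :
    Integrable I μ := by
  refine Integrable.of_bound hm.aestronglyMeasurable 1 (ae_of_all _ fun ω => ?_)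
  rcases h01 ω with h | h <;> simp [h]

/-- The expectation of a function of two independent Bernoulli random variables. -/
lemma integral_of_indep_bernoulli {Ω : Type*} [MeasurableSpace Ω] {μ : Measure Ω}
    [IsProbabilityMeasure μ] {I J : Ω → ℝ} (hI : Measurable I) (hJ : Measurable J)
    (hI01 : ∀ ω, I ω = 0 ∨ I ω = 1) (hJ01 : ∀ ω, J ω = 0 ∨ J ω = 1)
    (hindep : ProbabilityTheory.IndepFun I J μ) {p q : ℝ}
    (hp : (μ {ω | I ω = 1}).toReal = p) (hq : (μ {ω | J ω = 1}).toReal = q)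
    (f : ℝ → ℝ → ℝ) :
    ∫ ω, f (I ω) (J ω) ∂μ = p * q * f 1 1 + p * (1 - q) * f 1 0 + (1 - p) * q * f 0 1
      + (1 - p) * (1 - q) * f 0 0 := by
  have hIJ01 : ∀ ω, I ω * J ω = 0 ∨ I ω * J ω = 1 := fun ω => by
    rcases hI01 ω with h | h <;> rcases hJ01 ω with h' | h' <;> simp [h, h']
  have iI := integrable_of_zero_or_one (μ := μ) hI hI01
  have iJ := integrable_of_zero_or_one (μ := μ) hJ hJ01
  have iIJ := integrable_of_zero_or_one (μ := μ) (hI.mul hJ) hIJ01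
  have eI := integral_eq_prob_of_zero_or_one (μ := μ) hI hI01
  have eJ := integral_eq_prob_of_zero_or_one (μ := μ) hJ hJ01
  have eIJ : ∫ ω, I ω * J ω ∂μ = p * q := by
    rw [hindep.integral_fun_mul_eq_mul_integral hI.aestronglyMeasurable
      hJ.aestronglyMeasurable, eI, eJ, hp, hq]
  have hf : ∀ ω, f (I ω) (J ω) = f 0 0 + (f 1 0 - f 0 0) * I ω + (f 0 1 - f 0 0) * J ω
      + (f 1 1 - f 1 0 - f 0 1 + f 0 0) * (I ω * J ω) := fun ω => by
    rcases hI01 ω with h | h <;> rcases hJ01 ω with h' | h' <;> rw [h, h'] <;> ring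
  have i0 : Integrable (fun _ : Ω => f 0 0) μ := integrable_const _
  have i1 : Integrable (fun ω => (f 1 0 - f 0 0) * I ω) μ := iI.const_mul _
  have i2 : Integrable (fun ω => (f 0 1 - f 0 0) * J ω) μ := iJ.const_mul _
  have i3 : Integrable (fun ω => (f 1 1 - f 1 0 - f 0 1 + f 0 0) * (I ω * J ω)) μ :=
    iIJ.const_mul _
  have i01 : Integrable (fun ω => f 0 0 + (f 1 0 - f 0 0) * I ω) μ := i0.add i1
  have i012 : Integrable
      (fun ω => f 0 0 + (f 1 0 - f 0 0) * I ω + (f 0 1 - f 0 0) * J ω) μ := i01.add i2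
  simp_rw [hf]
  rw [integral_add i012 i3, integral_add i01 i2, integral_add i0 i1, integral_const_mul,
    integral_const_mul, integral_const_mul, eIJ, eI, eJ, hp, hq]
  simp only [integral_const, probReal_univ, one_smul]
  ring

/-- The fairness equations, with the expectations evaluated, have the stated solution. -/
lemma fairness_equations_iff {p q a b c : ℝ} (hp : p ∈ Set.Ioo (0 : ℝ) 1)
    (hq : q ∈ Set.Ioo (0 : ℝ) 1) (ha : 0 < a) (hb : 0 < b) (hc : 0 < c) :
    (a = (a + b + c) * (p * q * (a / (a + b)) + p * (1 - q)) ∧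
      b = (a + b + c) * (p * q * (b / (a + b)) + (1 - p) * q) ∧
      c = (a + b + c) * ((1 - p) * (1 - q))) ↔
    (a = c * (p / (1 - p)) * (1 - (1 - p) * (1 - q)) / (p * (1 - q) + q * (1 - p)) ∧
      b = c * (q / (1 - q)) * (1 - (1 - p) * (1 - q)) / (p * (1 - q) + q * (1 - p))) := by
  obtain ⟨hp0, hp1⟩ := hp
  obtain ⟨hq0, hq1⟩ := hq
  have hp' : 0 < 1 - p := sub_pos.2 hp1
  have hq' : 0 < 1 - q := sub_pos.2 hq1
  have hab : 0 < a + b := add_pos ha hb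
  have hD : 0 < p * (1 - q) + q * (1 - p) := by positivity
  have hN : 0 < 1 - (1 - p) * (1 - q) := by nlinarith
  constructor
  · rintro ⟨h1, h2, h3⟩
    have hratio : a * (q * (1 - p)) = b * (p * (1 - q)) := by
      have h : (a + b + c) * (a * (q * (1 - p))) = (a + b + c) * (b * (p * (1 - q))) := by
        field_simp at h1 h2
        have : (a + b) * ((a + b + c) * (a * (q * (1 - p))))
          = (a + b) * ((a + b + c) * (b * (p * (1 - q)))) := by
          linear_combination b * h1 - a * h2
        exact mul_left_cancel₀ hab.ne' this
      exact mul_left_cancel₀ (by positivity) h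
    have hsum : (a + b) * ((1 - p) * (1 - q)) = c * (1 - (1 - p) * (1 - q)) := by
      linear_combination -h3
    constructor
    · field_simp
      refine mul_left_cancel₀ hq'.ne' ?_
      linear_combination (1 - p) * (1 - q) * hratio + p * (1 - q) * hsum
    · field_simp
      refine mul_left_cancel₀ hp'.ne' ?_
      linear_combination -(1 - p) * (1 - q) * hratio + q * (1 - p) * hsum
  · rintro ⟨h1, h2⟩
    set N := 1 - (1 - p) * (1 - q) with hNdef
    set D := p * (1 - q) + q * (1 - p) with hDdef
    have hc_sum : c = (a + b + c) * ((1 - p) * (1 - q)) := by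
      have h : a + b = c * N / ((1 - p) * (1 - q)) := by
        rw [h1, h2, hDdef]
        field_simp
      rw [h, hNdef]
      field_simp
      ring
    have hfa : a / (a + b) = p * (1 - q) / D := by
      rw [h1, h2, hDdef]
      field_simp
    have hfb : b / (a + b) = q * (1 - p) / D := by
      rw [h1, h2, hDdef]
      field_simp
    have hS : a + b + c = c / ((1 - p) * (1 - q)) := by
      rw [eq_div_iff (by positivity)]
      exact hc_sum.symm
    refine ⟨?_, ?_, hc_sum⟩
    · rw [hfa, hS, h1, hNdef]
      field_simp
      rw [hDdef]
      ring
    · rw [hfb, hS, h2, hNdef]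
      field_simp
      rw [hDdef]
      ring

/-- Tavin risk-sharing scheme with two participants and an active administrator:
`I3 = (1 - I1) * (1 - I2)` and compensations
`W_i = (π1 + π2 + π3) * π_i * I_i / (π1*I1 + π2*I2 + π3*I3)`.
Actuarial fairness for all three agents holds iff `π1, π2` are the stated
multiples of `π3`. -/
theorem stmt_12 {Ω : Type*} [MeasurableSpace Ω] (μ : Measure Ω) [IsProbabilityMeasure μ]
    (I1 I2 : Ω → ℝ) (hm1 : Measurable I1) (hm2 : Measurable I2)
    (h01I1 : ∀ ω, I1 ω = 0 ∨ I1 ω = 1) (h01I2 : ∀ ω, I2 ω = 0 ∨ I2 ω = 1)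
    (hindep : ProbabilityTheory.IndepFun I1 I2 μ)
    (p1 p2 : ℝ) (hp1 : p1 ∈ Set.Ioo (0 : ℝ) 1) (hp2 : p2 ∈ Set.Ioo (0 : ℝ) 1)
    (hI1 : (μ {ω | I1 ω = 1}).toReal = p1) (hI2 : (μ {ω | I2 ω = 1}).toReal = p2)
    (π1 π2 π3 : ℝ) (hπ1 : 0 < π1) (hπ2 : 0 < π2) (hπ3 : 0 < π3) :
    (π1 = ∫ ω, (π1 + π2 + π3) * (π1 * I1 ω)
        / (π1 * I1 ω + π2 * I2 ω + π3 * ((1 - I1 ω) * (1 - I2 ω))) ∂μ ∧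
     π2 = ∫ ω, (π1 + π2 + π3) * (π2 * I2 ω)
        / (π1 * I1 ω + π2 * I2 ω + π3 * ((1 - I1 ω) * (1 - I2 ω))) ∂μ ∧
     π3 = ∫ ω, (π1 + π2 + π3) * (π3 * ((1 - I1 ω) * (1 - I2 ω)))
        / (π1 * I1 ω + π2 * I2 ω + π3 * ((1 - I1 ω) * (1 - I2 ω))) ∂μ) ↔
    (π1 = π3 * (p1 / (1 - p1)) * (1 - (1 - p1) * (1 - p2))
            / (p1 * (1 - p2) + p2 * (1 - p1)) ∧
     π2 = π3 * (p2 / (1 - p2)) * (1 - (1 - p1) * (1 - p2))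
            / (p1 * (1 - p2) + p2 * (1 - p1))) := by
  have key := integral_of_indep_bernoulli hm1 hm2 h01I1 h01I2 hindep hI1 hI2
  rw [key fun x y => (π1 + π2 + π3) * (π1 * x) / (π1 * x + π2 * y + π3 * ((1 - x) * (1 - y))),
    key fun x y => (π1 + π2 + π3) * (π2 * y) / (π1 * x + π2 * y + π3 * ((1 - x) * (1 - y))),
    key fun x y => (π1 + π2 + π3) * (π3 * ((1 - x) * (1 - y)))
      / (π1 * x + π2 * y + π3 * ((1 - x) * (1 - y))),
    ← fairness_equations_iff hp1 hp2 hπ1 hπ2 hπ3]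
  have hab : π1 + π2 ≠ 0 := by positivity
  refine and_congr (Eq.congr_right ?_) (and_congr (Eq.congr_right ?_) (Eq.congr_right ?_)) <;>
  · simp only [mul_one, mul_zero, sub_self, sub_zero, add_zero, zero_add, zero_div]
    field_simp
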